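/- Let f : ℂⁿ → ℂ (n ≥ 2) be a function that is holomorphic on the set of points where at most two coordinates coincide (i.e., holomorphic at every point (z₁,…,zₙ) such that there do not exist two distinct unordered pairs {i,j} ≠ {k,l} with zᵢ = zⱼ and z_k = z_l). Then f extends to an entire function on ℂⁿ. -/

import Mathlib

/-- The set of points of `ℂⁿ` where at most two coordinates coincide: there do not exist
two distinct unordered pairs `{i,j} ≠ {k,l}` of indices with `z i = z j` and `z k = z l`. -/
def atMostTwoCoincide {n : ℕ} (z : Fin n → ℂ) : Prop :=
  ¬ ∃ i j k l : Fin n, i ≠ j ∧ k ≠ l ∧ ¬((i = k ∧ j = l) ∨ (i = l ∧ j = k)) ∧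
      z i = z j ∧ z k = z l

open Filter Topology MeasureTheory
open scoped NNReal ENNReal

theorem taylor_norm_le {E : Type*} [NormedAddCommGroup E] [NormedSpace ℂ E]
    {f : E → ℂ} {q : FormalMultilinearSeries ℂ E ℂ} {y : E} {r : ℝ≥0∞}
    (h : HasFPowerSeriesOnBall f q y r) (k : ℕ) :
    ‖((k.factorial : ℂ)⁻¹ • iteratedFDeriv ℂ k f y)‖ ≤ ‖q k‖ := by
  refine ContinuousMultilinearMap.opNorm_le_bound (norm_nonneg _) fun m => ?_
  rw [_root_.smul_apply, h.iteratedFDeriv_eq_sum_of_completeSpace, norm_smul]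
  have h1 : ‖∑ σ : Equiv.Perm (Fin k), q k (fun i => m (σ i))‖
      ≤ ∑ σ : Equiv.Perm (Fin k), ‖q k‖ * ∏ i, ‖m i‖ := by
    refine norm_sum_le_of_le _ fun σ _ => ?_
    refine ((q k).le_opNorm _).trans_eq ?_
    rw [Equiv.prod_comp σ (fun i => ‖m i‖)]
  rw [Finset.sum_const, Finset.card_univ, Fintype.card_perm, Fintype.card_fin, nsmul_eq_mul] at h1
  have h2 : (0 : ℝ) < k.factorial := by exact_mod_cast k.factorial_pos
  rw [norm_inv, Complex.norm_natCast, inv_mul_le_iff₀ h2]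
  exact h1

theorem taylor_apply {E : Type*} [NormedAddCommGroup E] [NormedSpace ℂ E]
    {f : E → ℂ} {q : FormalMultilinearSeries ℂ E ℂ} {y : E} {r : ℝ≥0∞}
    (h : HasFPowerSeriesOnBall f q y r) (k : ℕ) (w : E) :
    ((k.factorial : ℂ)⁻¹ • iteratedFDeriv ℂ k f y) (fun _ => w) = q k (fun _ => w) := by
  rw [_root_.smul_apply, h.iteratedFDeriv_eq_sum_of_completeSpace]
  rw [Finset.sum_const, Finset.card_univ, Fintype.card_perm, Fintype.card_fin, nsmul_eq_mul,
    smul_eq_mul, inv_mul_cancel_left₀]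
  exact_mod_cast k.factorial_ne_zero

def TaylorBd {E : Type*} [NormedAddCommGroup E] [NormedSpace ℂ E]
    (f : E → ℂ) (C ρ : ℝ) (y : E) : Prop :=
  (∀ k : ℕ, ‖((k.factorial : ℂ)⁻¹ • iteratedFDeriv ℂ k f y)‖ * ρ ^ k ≤ C) ∧
  ∀ w : E, ‖w‖ < ρ →
    HasSum (fun k : ℕ => ((k.factorial : ℂ)⁻¹ • iteratedFDeriv ℂ k f y) (fun _ => w)) (f (y + w))

theorem TaylorBd.mono {E : Type*} [NormedAddCommGroup E] [NormedSpace ℂ E]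
    {f : E → ℂ} {C C' ρ ρ' : ℝ} {y : E} (h : TaylorBd f C ρ y) (hC : C ≤ C') (h0 : 0 ≤ ρ')
    (hρ : ρ' ≤ ρ) : TaylorBd f C' ρ' y := by
  refine ⟨fun k => le_trans ?_ ((h.1 k).trans hC), fun w hw => h.2 w (hw.trans_le hρ)⟩
  gcongr

theorem exists_taylorBd {E : Type*} [NormedAddCommGroup E] [NormedSpace ℂ E]
    {f : E → ℂ} {x : E} (hf : AnalyticAt ℂ f x) :
    ∃ C ρ : ℝ, 0 < ρ ∧ ∀ᶠ y in 𝓝 x, TaylorBd f C ρ y := by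
  obtain ⟨p, r, hp⟩ := hf
  obtain ⟨s, hs0, hsr⟩ := ENNReal.lt_iff_exists_nnreal_btwn.1 hp.r_pos
  have hs0' : 0 < s := by exact_mod_cast hs0
  set ρ : ℝ≥0 := s / 2 with hρ
  have hρ0 : 0 < ρ := by positivity
  have hρs : ρ + ρ = s := add_halves s
  have hrad : ((ρ : ℝ≥0∞) + ρ) < p.radius := by
    rw [← ENNReal.coe_add, hρs]; exact hsr.trans_le hp.r_le
  have hsum := p.changeOriginSeries_summable_aux₁ hrad
  refine ⟨((∑' s : Σ k l : ℕ, { s : Finset (Fin (k + l)) // s.card = l },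
      ‖p (s.1 + s.2.1)‖₊ * ρ ^ s.2.1 * ρ ^ s.1 : ℝ≥0) : ℝ), ρ, by exact_mod_cast hρ0, ?_⟩
  filter_upwards [Metric.ball_mem_nhds x (show (0 : ℝ) < ρ by exact_mod_cast hρ0)] with y hy
  have hy' : ‖y - x‖₊ < ρ := by
    rw [Metric.mem_ball, dist_eq_norm] at hy; exact_mod_cast hy
  have hyr : (‖y - x‖₊ : ℝ≥0∞) < r := by
    refine lt_of_lt_of_le ?_ hsr.le
    rw [← hρs]
    exact_mod_cast hy'.trans_le (le_add_of_nonneg_left zero_le)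
  have hq := hp.changeOrigin hyr
  rw [add_sub_cancel] at hq
  refine ⟨fun k => ?_, fun w hw => ?_⟩
  · refine le_trans (mul_le_mul_of_nonneg_right (taylor_norm_le hq k) (by positivity)) ?_
    have h1 := p.nnnorm_changeOrigin_le k (x := y - x) (hyr.trans_le hp.r_le)
    have h2 := (NNReal.summable_sigma.1 hsum)
    have h3 : ‖p.changeOrigin (y - x) k‖₊ * ρ ^ k ≤ ∑' s : Σ k l : ℕ, { s : Finset (Fin (k + l)) // s.card = l },
      ‖p (s.1 + s.2.1)‖₊ * ρ ^ s.2.1 * ρ ^ s.1 := by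
      rw [hsum.tsum_sigma' h2.1]
      refine le_trans ?_ (h2.2.le_tsum k (fun _ _ => zero_le))
      dsimp only
      rw [NNReal.tsum_mul_right]
      gcongr
      refine h1.trans ?_
      have h4 := p.changeOriginSeries_summable_aux₂ (r := ρ) (lt_of_le_of_lt (by simp) hrad) k
      refine Summable.tsum_le_tsum (fun i => by gcongr) ?_ h4
      exact NNReal.summable_of_le (fun i => by gcongr) h4
    exact_mod_cast h3
  · simp_rw [taylor_apply hq]
    refine hq.hasSum ?_
    rw [mem_eball_zero_iff, lt_tsub_iff_right]
    refine lt_of_le_of_lt ?_ hsr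
    rw [← hρs]
    have : ‖w‖₊ ≤ ρ := by exact_mod_cast hw.le
    rw [enorm_eq_nnnorm]
    exact_mod_cast add_le_add this hy'.le

theorem exists_taylorBd_compact {E : Type*} [NormedAddCommGroup E] [NormedSpace ℂ E]
    {f : E → ℂ} {K : Set E} (hK : IsCompact K) (hf : ∀ x ∈ K, AnalyticAt ℂ f x) :
    ∃ C ρ : ℝ, 0 < ρ ∧ ∀ y ∈ K, TaylorBd f C ρ y := by
  refine hK.induction_on (p := fun K => ∃ C ρ : ℝ, 0 < ρ ∧ ∀ y ∈ K, TaylorBd f C ρ y)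
    ⟨0, 1, one_pos, by simp⟩ ?_ ?_ ?_
  · rintro s t hst ⟨C, ρ, h, h'⟩
    exact ⟨C, ρ, h, fun y hy => h' y (hst hy)⟩
  · rintro s t ⟨C, ρ, h, h'⟩ ⟨C1, ρ1, h1, h1'⟩
    refine ⟨max C C1, min ρ ρ1, lt_min h h1, ?_⟩
    rintro y (hy | hy)
    · exact (h' y hy).mono (le_max_left _ _) (lt_min h h1).le (min_le_left _ _)
    · exact (h1' y hy).mono (le_max_right _ _) (lt_min h h1).le (min_le_right _ _)
  · intro x hx
    obtain ⟨C, ρ, h, h'⟩ := exists_taylorBd (hf x hx)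
    exact ⟨_, mem_nhdsWithin_of_mem_nhds h', C, ρ, h, fun y hy => hy⟩

theorem analyticAt_integral {E : Type*} [NormedAddCommGroup E] [NormedSpace ℂ E]
    {f : E → ℂ} {γ : ℝ → E} (hγ : Continuous γ) (a b : ℝ) (z : E)
    (hf : ∀ t, AnalyticAt ℂ f (z + γ t)) :
    AnalyticAt ℂ (fun w => ∫ t in a..b, f (w + γ t)) z := by
  obtain ⟨C, ρ, hρ, hT⟩ := exists_taylorBd_compact (f := f) (K := (fun t => z + γ t) '' Set.uIcc a b)
    (isCompact_uIcc.image (by fun_prop)) (by rintro _ ⟨t, _, rfl⟩; exact hf t)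
  have hT' : ∀ t ∈ Set.uIoc a b, TaylorBd f C ρ (z + γ t) := fun t ht =>
    hT _ ⟨t, Set.uIoc_subset_uIcc ht, rfl⟩
  set T : (k : ℕ) → ℝ → ContinuousMultilinearMap ℂ (fun _ : Fin k => E) ℂ :=
    fun k t => (k.factorial : ℂ)⁻¹ • iteratedFDeriv ℂ k f (z + γ t) with hTdef
  have hcont : ∀ k, Continuous (T k) := by
    intro k
    suffices h0 : Continuous (fun t => iteratedFDeriv ℂ k f (z + γ t)) from
      h0.const_smul ((k.factorial : ℂ)⁻¹)
    rw [continuous_iff_continuousAt]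
    intro t
    have h1 : ContinuousAt (iteratedFDeriv ℂ k f) (z + γ t) := by
      have : AnalyticOnNhd ℂ (iteratedFDeriv ℂ k f) {x | AnalyticAt ℂ f x} :=
        AnalyticOnNhd.iteratedFDeriv (fun x hx => hx) k
      exact (this _ (hf t)).continuousAt
    exact ContinuousAt.comp (f := fun t => z + γ t) h1 (by fun_prop)
  refine ⟨fun k => ∫ t in a..b, T k t, ENNReal.ofReal ρ, ?_, by simpa using hρ, ?_⟩
  · refine FormalMultilinearSeries.le_radius_of_bound _ (C * |b - a|) fun k => ?_
    rw [Real.coe_toNNReal _ hρ.le]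
    have : ‖∫ t in a..b, T k t‖ ≤ (C / ρ ^ k) * |b - a| := by
      refine intervalIntegral.norm_integral_le_of_norm_le_const fun t ht => ?_
      rw [le_div_iff₀ (by positivity)]
      exact (hT' t ht).1 k
    calc _ ≤ (C / ρ ^ k) * |b - a| * ρ ^ k := by gcongr
      _ = _ := by field_simp
  · intro w hw
    have hw' : ‖w‖ < ρ := by
      rw [Metric.eball_ofReal, mem_ball_zero_iff] at hw; exact hw
    have key : HasSum (fun k => ∫ t in a..b, T k t (fun _ => w)) (∫ t in a..b, f (z + w + γ t)) := by
      refine intervalIntegral.hasSum_integral_of_dominated_convergence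
        (fun k _ => C * (‖w‖ / ρ) ^ k) ?_ ?_ ?_ ?_ ?_
      · intro k
        exact (((ContinuousMultilinearMap.apply ℂ (fun _ : Fin k => E) ℂ (fun _ => w)).continuous.comp
          (hcont k))).aestronglyMeasurable
      · intro k
        refine Eventually.of_forall fun t ht => ?_
        refine ((T k t).le_opNorm _).trans ?_
        have := (hT' t ht).1 k
        rw [← le_div_iff₀ (by positivity)] at this
        simp only [Finset.prod_const, Finset.card_univ, Fintype.card_fin]
        calc _ ≤ (C / ρ ^ k) * ‖w‖ ^ k := by gcongr
          _ = _ := by rw [div_pow]; ring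
      · refine Eventually.of_forall fun t ht => ?_
        exact (summable_geometric_of_lt_one (by positivity) ((div_lt_one hρ).2 hw')).mul_left _
      · exact intervalIntegrable_const
      · refine Eventually.of_forall fun t ht => ?_
        have := (hT' t ht).2 w hw'
        rwa [add_right_comm] at this
    refine key.congr_fun ?_
    intro k
    have := (ContinuousMultilinearMap.apply ℂ (fun _ : Fin k => E) ℂ
      (fun _ => w)).intervalIntegral_comp_comm ((hcont k).intervalIntegrable (μ := volume) a b)
    exact this.symm

/-- the direction of the slicing lines -/
def dirV (n : ℕ) : Fin n → ℂ := fun i => ((i : ℕ) : ℂ)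

theorem dirV_ne {n : ℕ} {i j : Fin n} (h : i ≠ j) : dirV n i - dirV n j ≠ 0 := by
  rw [sub_ne_zero]
  intro h'
  unfold dirV at h'
  exact h (Fin.ext (by exact_mod_cast h'))

theorem exists_radius {n : ℕ} (z : Fin n → ℂ) :
    ∃ r : ℝ, 0 < r ∧ ∀ t : ℂ, ‖t‖ = r → atMostTwoCoincide (z + t • dirV n) := by
  have hfin : (Set.range fun q : Fin n × Fin n =>
      ‖(z q.2 - z q.1) / (dirV n q.1 - dirV n q.2)‖).Finite := Set.finite_range _
  obtain ⟨r, hr, hr'⟩ := (Set.Ioi_infinite (0 : ℝ)).exists_notMem_finite hfin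
  refine ⟨r, hr, ?_⟩
  rintro t ht ⟨i, j, k, l, hij, -, -, h, -⟩
  refine hr' ⟨(i, j), ?_⟩
  rw [← ht]
  dsimp only
  congr 1
  rw [div_eq_iff (dirV_ne hij)]
  simp only [Pi.add_apply, Pi.smul_apply, smul_eq_mul] at h
  linear_combination -h

def goodD (n : ℕ) : Set (Fin n → ℂ) := {z | ∀ t : ℂ, atMostTwoCoincide (z + t • dirV n)}

theorem dense_goodD (n : ℕ) : Dense (goodD n) := by
  let Q := {q : Fin n × Fin n × Fin n × Fin n // q.1 ≠ q.2.1 ∧ q.2.2.1 ≠ q.2.2.2 ∧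
    ¬((q.1 = q.2.2.1 ∧ q.2.1 = q.2.2.2) ∨ (q.1 = q.2.2.2 ∧ q.2.1 = q.2.2.1))}
  let P : Fin n → ((Fin n → ℂ) →L[ℂ] ℂ) := fun i => ContinuousLinearMap.proj i
  let p : Q → ((Fin n → ℂ) →L[ℂ] ℂ) := fun q =>
    (dirV n q.1.2.2.1 - dirV n q.1.2.2.2) • (P q.1.1 - P q.1.2.1) -
      (dirV n q.1.1 - dirV n q.1.2.1) • (P q.1.2.2.1 - P q.1.2.2.2)
  have hp : ∀ q z, p q z = (dirV n q.1.2.2.1 - dirV n q.1.2.2.2) * (z q.1.1 - z q.1.2.1) -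
      (dirV n q.1.1 - dirV n q.1.2.1) * (z q.1.2.2.1 - z q.1.2.2.2) := by
    intro q z; simp [p, P]
  have hD : Dense (⋂ q : Q, {z | p q z ≠ 0}) := by
    refine dense_iInter_of_isOpen (fun q => ?_) (fun q => ?_)
    · exact isOpen_ne_fun (p q).continuous continuous_const
    · have hne : ∃ z, p q z ≠ 0 := by
        obtain ⟨⟨i, j, k, l⟩, hij, hkl, h⟩ := q
        dsimp only at hij hkl h
        by_cases hi : i = k ∨ i = l
        · have hj : j ≠ k ∧ j ≠ l := by
            constructor <;> rintro rfl <;> rcases hi with rfl | rfl <;> simp_all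
          refine ⟨Pi.single j 1, ?_⟩
          rw [hp]
          simp [hij, hj.1.symm, hj.2.symm, dirV_ne hkl.symm]
        · push Not at hi
          refine ⟨Pi.single i 1, ?_⟩
          rw [hp]
          simp [hij.symm, hi.1.symm, hi.2.symm, dirV_ne hkl]
      have : interior ((LinearMap.ker (p q).toLinearMap : Submodule ℂ (Fin n → ℂ)) : Set (Fin n → ℂ)) = ∅ := by
        by_contra hcon
        have htop := Submodule.eq_top_of_nonempty_interior' _ (Set.nonempty_iff_ne_empty.2 hcon)
        obtain ⟨z, hz⟩ := hne
        apply hz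
        have : z ∈ LinearMap.ker (p q).toLinearMap := by rw [htop]; trivial
        exact this
      exact interior_eq_empty_iff_dense_compl.1 this
  refine hD.mono fun z hz t => ?_
  rintro ⟨i, j, k, l, hij, hkl, h, h1, h2⟩
  have := Set.mem_iInter.1 hz ⟨(i, j, k, l), hij, hkl, h⟩
  apply this
  rw [hp]
  simp only [Pi.add_apply, Pi.smul_apply, smul_eq_mul] at h1 h2
  dsimp only
  linear_combination (dirV n k - dirV n l) * h1 - (dirV n i - dirV n j) * h2

/-- average of `f` over the circle of radius `r` in the slicing line through `z` -/
noncomputable def avgF {n : ℕ} (f : (Fin n → ℂ) → ℂ) (r : ℝ) (z : Fin n → ℂ) : ℂ :=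
  Real.circleAverage (fun t : ℂ => f (z + t • dirV n)) 0 r

theorem avgF_analytic {n : ℕ} {f : (Fin n → ℂ) → ℂ}
    (hf : ∀ z : Fin n → ℂ, atMostTwoCoincide z → AnalyticAt ℂ f z) {r : ℝ} {z : Fin n → ℂ}
    (hr : 0 < r) (hz : ∀ t : ℂ, ‖t‖ = r → atMostTwoCoincide (z + t • dirV n)) :
    AnalyticAt ℂ (avgF f r) z := by
  have h := analyticAt_integral (f := f) (γ := fun θ => circleMap 0 r θ • dirV n)
    (by fun_prop) 0 (2 * Real.pi) z
    (fun t => hf _ (hz _ (by simp [abs_of_pos hr])))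
  have h2 := (analyticAt_const (v := (((2 * Real.pi)⁻¹ : ℝ) : ℂ))).mul h
  refine h2.congr (Eventually.of_forall fun w => ?_)
  simp [avgF, Real.circleAverage_def]

theorem avgF_eq {n : ℕ} {f : (Fin n → ℂ) → ℂ}
    (hf : ∀ z : Fin n → ℂ, atMostTwoCoincide z → AnalyticAt ℂ f z) (r : ℝ) {z : Fin n → ℂ}
    (hz : z ∈ goodD n) : avgF f r z = f z := by
  have hd : Differentiable ℂ (fun t : ℂ => f (z + t • dirV n)) := fun t =>
    (hf _ (hz t)).differentiableAt.comp t (f := fun t : ℂ => z + t • dirV n) (by fun_prop)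
  have := hd.diffContOnCl (s := Metric.ball 0 |r|) |>.circleAverage
  simpa [avgF] using this

theorem eq_of_dense {n : ℕ} {F G f : (Fin n → ℂ) → ℂ} {w : Fin n → ℂ} (hF : ContinuousAt F w)
    (hG : ContinuousAt G w) (h1 : ∀ z ∈ goodD n, F z = f z) (h2 : ∀ z ∈ goodD n, G z = f z) :
    F w = G w := by
  have : (𝓝[goodD n] w).NeBot := mem_closure_iff_nhdsWithin_neBot.1 (dense_goodD n w)
  refine tendsto_nhds_unique (hF.tendsto.mono_left (nhdsWithin_le_nhds (s := goodD n)))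
    ((hG.tendsto.mono_left nhdsWithin_le_nhds).congr' ?_)
  filter_upwards [self_mem_nhdsWithin] with z hz
  rw [h1 z hz, h2 z hz]

theorem stmt_1 {n : ℕ} (hn : 2 ≤ n) (f : (Fin n → ℂ) → ℂ)
    (hf : ∀ z : Fin n → ℂ, atMostTwoCoincide z → AnalyticAt ℂ f z) :
    ∃ g : (Fin n → ℂ) → ℂ, (∀ z, AnalyticAt ℂ g z) ∧
      ∀ z, atMostTwoCoincide z → g z = f z := by
  choose r hr0 hr using fun z : Fin n → ℂ => exists_radius z
  have han : ∀ z, AnalyticAt ℂ (avgF f (r z)) z := fun z => avgF_analytic hf (hr0 z) (hr z)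
  refine ⟨fun z => avgF f (r z) z, fun z => ?_, fun z hz => ?_⟩
  · refine (han z).congr ?_
    filter_upwards [(han z).eventually_analyticAt] with w hw
    exact eq_of_dense hw.continuousAt (han w).continuousAt
      (fun x hx => avgF_eq hf _ hx) (fun x hx => avgF_eq hf _ hx)
  · exact eq_of_dense (han z).continuousAt (hf z hz).continuousAt
      (fun x hx => avgF_eq hf _ hx) (fun x hx => rfl)
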